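/- Let Γ be a local bigness notion for a complete first-order theory T. Declare a complete type p ∈ S(A, M), for A_Γ ⊆ A ⊆ M, to be Γ-big iff the conjunction of every finite subset of p is a Γ-big formula in M. Then this assignment is a global bigness notion for T: it satisfies local character, extension, and existence. Moreover, if Γ is invariant as a local bigness notion, then the induced global bigness notion is invariant. -/

import Mathlib

namespace Shelah482

open FirstOrder Language Cardinal

universe u

variable {L : FirstOrder.Language.{u, u}} {T : L.Theory} {γ : Type u}

/-- The conjunction of a finite list of formulas. -/
def listConj {α : Type u} : List (L.Formula α) → L.Formula α
  | [] => ⊤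
  | φ :: l => φ ⊓ listConj l

/-- A *local bigness notion* `Γ` for a theory `T` (here the parameter set `A_Γ` of `Γ`
is absorbed into the language as constant symbols, so that all models of the complete
theory `T` elementarily extend `M_Γ` after naming these parameters): for every model
`M` of `T` it declares certain formulas `φ(x̄_Γ, ā)` with parameters `ā` from `M` to be
*`Γ`-big* (the remaining ones being *`Γ`-small*), in such a way that the `Γ`-small
formulas form a proper ideal which is preserved by all automorphisms of `M` (such
automorphisms automatically fix the parameters `A_Γ`, being constants, pointwise). -/
structure LocalBigness (L : FirstOrder.Language.{u, u}) (T : L.Theory) (γ : Type u) :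
    Type (u + 1) where
  Big : ∀ M : Theory.ModelType.{u, u, u} T, L.Formula (γ ⊕ M) → Prop
  aut_invariant : ∀ (M : Theory.ModelType.{u, u, u} T) (g : M ≃[L] M)
      (φ : L.Formula (γ ⊕ M)), Big M (φ.relabel (Sum.map id ⇑g)) ↔ Big M φ
  mono : ∀ (M : Theory.ModelType.{u, u, u} T) (φ ψ : L.Formula (γ ⊕ M)),
      (∀ x : γ → M, φ.Realize (Sum.elim x id) → ψ.Realize (Sum.elim x id)) →
      Big M φ → Big M ψ
  small_sup : ∀ (M : Theory.ModelType.{u, u, u} T) (φ ψ : L.Formula (γ ⊕ M)),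
      ¬ Big M φ → ¬ Big M ψ → ¬ Big M (φ ⊔ ψ)
  small_bot : ∀ M : Theory.ModelType.{u, u, u} T, ¬ Big M (⊥ : L.Formula (γ ⊕ M))
  exists_big : ∀ M : Theory.ModelType.{u, u, u} T, ∃ φ, Big M φ

/-- The complete type of the tuple `a` over the parameter set `A` in `M`. -/
def typeOf (M : Theory.ModelType.{u, u, u} T) (A : Set M) (a : γ → M) :
    Set (L.Formula (γ ⊕ ↥A)) :=
  { φ | φ.Realize (Sum.elim a Subtype.val) }

/-- A (partial) type `p` over `A ⊆ M` is `Γ`-big in `M` if the conjunction of every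
finite subset of `p` is a `Γ`-big formula in `M`. -/
def LocalBigness.BigType (Γ : LocalBigness L T γ) (M : Theory.ModelType.{u, u, u} T)
    (A : Set M) (p : Set (L.Formula (γ ⊕ ↥A))) : Prop :=
  ∀ l : List (L.Formula (γ ⊕ ↥A)), (∀ φ ∈ l, φ ∈ p) →
    Γ.Big M ((listConj l).relabel (Sum.map id Subtype.val))

/-- `q` is a complete type over `A` in `M` (in the variables `γ`): a maximal set of
formulas with parameters in `A` which is consistent with the elementary diagram of
`M`, i.e. finitely satisfiable in `M`. -/
def IsCompleteTypeOver (M : Theory.ModelType.{u, u, u} T) (A : Set M)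
    (q : Set (L.Formula (γ ⊕ ↥A))) : Prop :=
  (∀ l : List (L.Formula (γ ⊕ ↥A)), (∀ φ ∈ l, φ ∈ q) →
      ∃ x : γ → M, (listConj l).Realize (Sum.elim x Subtype.val)) ∧
  (∀ φ : L.Formula (γ ⊕ ↥A), φ ∈ q ∨ φ.not ∈ q)

/-- The restriction of a type over `A` to a type over a subset `B ⊆ A`. -/
def restrictT {M : Theory.ModelType.{u, u, u} T} {A B : Set M} (h : B ⊆ A)
    (q : Set (L.Formula (γ ⊕ ↥A))) : Set (L.Formula (γ ⊕ ↥B)) :=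
  { φ | φ.relabel (Sum.map id (Set.inclusion h)) ∈ q }

/-- A local bigness notion is *invariant* if whether `φ(x̄_Γ, ā)` is `Γ`-big in a model
depends only on `φ(x̄, ȳ)` and on the complete first-order type of `ā` over `A_Γ`
(the parameters `A_Γ` being constants of the language). -/
def LocalBigness.Invariant (Γ : LocalBigness L T γ) : Prop :=
  ∀ (M N : Theory.ModelType.{u, u, u} T) (n : ℕ) (φ : L.Formula (γ ⊕ Fin n))
    (a : Fin n → M) (b : Fin n → N),
    (∀ ψ : L.Formula (Fin n), ψ.Realize a ↔ ψ.Realize b) →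
    (Γ.Big M (φ.relabel (Sum.map id a)) ↔ Γ.Big N (φ.relabel (Sum.map id b)))

/-- The global-invariance property for a bigness predicate on complete types:
bigness of `tp(ā, A, M)` is preserved by elementary maps fixing the parameters `A_Γ`
(which are constants) pointwise. -/
def InvariantTypePred
    (BigP : ∀ (M : Theory.ModelType.{u, u, u} T) (A : Set M),
      Set (L.Formula (γ ⊕ ↥A)) → Prop) : Prop :=
  ∀ (M N : Theory.ModelType.{u, u, u} T) (A : Set M) (B : Set N)
    (a : γ → M) (b : γ → N) (e : ↥A → ↥B), Function.Surjective e →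
    (∀ φ : L.Formula (γ ⊕ ↥A),
      φ.Realize (Sum.elim a Subtype.val) ↔
        (φ.relabel (Sum.map id e)).Realize (Sum.elim b Subtype.val)) →
    (BigP M A (typeOf M A a) ↔ BigP N B (typeOf N B b))

theorem realize_listConj {α K : Type u} [L.Structure K] (l : List (L.Formula α)) (v : α → K) :
    (listConj l).Realize v ↔ ∀ φ ∈ l, φ.Realize v := by
  induction l with
  | nil => simp [listConj]
  | cons φ l ih => simp [listConj, ih]

theorem realize_relabel_sumMap {γ α β K : Type*} [L.Structure K] (φ : L.Formula (γ ⊕ α))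
    (f : α → β) (x : γ → K) (v : β → K) :
    (φ.relabel (Sum.map id f)).Realize (Sum.elim x v) ↔ φ.Realize (Sum.elim x (v ∘ f)) := by
  rw [Formula.realize_relabel, Sum.elim_comp_map, Function.comp_id]

/-- Every formula uses only finitely many of the parameters it is allowed to mention. -/
theorem exists_finite_params {α : Type u} (φ : L.Formula (γ ⊕ α)) :
    ∃ (n : ℕ) (c : Fin n → α) (φ' : L.Formula (γ ⊕ Fin n)),
      ∀ (K : Type u) [L.Structure K] (x : γ → K) (v : α → K),
        φ'.Realize (Sum.elim x (v ∘ c)) ↔ φ.Realize (Sum.elim x v) := by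
  classical
  set S : Finset α := φ.freeVarFinset.toRight
  let f : φ.freeVarFinset → γ ⊕ Fin S.card
    | ⟨.inl g, _⟩ => .inl g
    | ⟨.inr a, h⟩ => .inr (S.equivFin ⟨a, Finset.mem_toRight.2 h⟩)
  refine ⟨S.card, fun i => (S.equivFin.symm i).1, BoundedFormula.restrictFreeVar φ f,
    fun K _ x v => BoundedFormula.realize_restrictFreeVar (Sum.elim x v) ?_⟩
  rintro ⟨g | a, h⟩ <;> simp [f]

theorem IsCompleteTypeOver.mem_of_imp {M : Theory.ModelType.{u, u, u} T} {A : Set M}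
    {q : Set (L.Formula (γ ⊕ ↥A))} (hq : IsCompleteTypeOver M A q)
    {l : List (L.Formula (γ ⊕ ↥A))} (hl : ∀ φ ∈ l, φ ∈ q) {ψ : L.Formula (γ ⊕ ↥A)}
    (h : ∀ x : γ → M, (listConj l).Realize (Sum.elim x Subtype.val) →
      ψ.Realize (Sum.elim x Subtype.val)) : ψ ∈ q := by
  refine (hq.2 ψ).resolve_right fun hn => ?_
  obtain ⟨x, hx⟩ := hq.1 (ψ.not :: l) (by simpa using ⟨hn, hl⟩)
  rw [listConj, Formula.realize_inf] at hx
  exact hx.1 (h x hx.2)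

theorem LocalBigness.big_congr (Γ : LocalBigness L T γ) (M : Theory.ModelType.{u, u, u} T)
    {φ ψ : L.Formula (γ ⊕ M)}
    (h : ∀ x : γ → M, φ.Realize (Sum.elim x id) ↔ ψ.Realize (Sum.elim x id)) :
    Γ.Big M φ ↔ Γ.Big M ψ :=
  ⟨Γ.mono M φ ψ fun x => (h x).1, Γ.mono M ψ φ fun x => (h x).2⟩

/-- The filter generated by the complements of the solution sets of small formulas. -/
def LocalBigness.filter (Γ : LocalBigness L T γ) (M : Theory.ModelType.{u, u, u} T) :
    Filter (γ → M) where
  sets := { s | ∃ φ, ¬ Γ.Big M φ ∧ ∀ x ∉ s, φ.Realize (Sum.elim x id) }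
  univ_sets := ⟨⊥, Γ.small_bot M, by simp⟩
  sets_of_superset := by
    rintro s t ⟨φ, hφ, h⟩ hst
    exact ⟨φ, hφ, fun x hx => h x fun hs => hx (hst hs)⟩
  inter_sets := by
    rintro s t ⟨φ, hφ, h⟩ ⟨ψ, hψ, h'⟩
    refine ⟨φ ⊔ ψ, Γ.small_sup M φ ψ hφ hψ, fun x hx => ?_⟩
    rw [Formula.realize_sup]
    by_cases hs : x ∈ s
    · exact Or.inr (h' x fun ht => hx ⟨hs, ht⟩)
    · exact Or.inl (h x hs)

theorem LocalBigness.mem_filter (Γ : LocalBigness L T γ) {M : Theory.ModelType.{u, u, u} T}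
    {s : Set (γ → M)} :
    s ∈ Γ.filter M ↔ ∃ φ, ¬ Γ.Big M φ ∧ ∀ x ∉ s, φ.Realize (Sum.elim x id) :=
  Iff.rfl

instance LocalBigness.filter_neBot (Γ : LocalBigness L T γ) (M : Theory.ModelType.{u, u, u} T) :
    (Γ.filter M).NeBot := by
  refine ⟨fun h => ?_⟩
  obtain ⟨φ, hφ, h⟩ := Γ.mem_filter.1 (Filter.empty_mem_iff_bot.2 h)
  obtain ⟨ψ, hψ⟩ := Γ.exists_big M
  exact hφ (Γ.mono M ψ φ (fun x _ => h x (Set.notMem_empty x)) hψ)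

/-- The type over `A` of an ultrafilter on tuples of `M`. -/
def typeOfUltrafilter {M : Theory.ModelType.{u, u, u} T} (A : Set M)
    (U : Ultrafilter (γ → M)) : Set (L.Formula (γ ⊕ ↥A)) :=
  { φ | ∀ᶠ x in (U : Filter (γ → M)), φ.Realize (Sum.elim x Subtype.val) }

theorem eventually_realize_listConj {M : Theory.ModelType.{u, u, u} T} {A : Set M}
    {F : Filter (γ → M)} {l : List (L.Formula (γ ⊕ ↥A))}
    (hl : ∀ φ ∈ l, ∀ᶠ x in F, φ.Realize (Sum.elim x Subtype.val)) :
    ∀ᶠ x in F, (listConj l).Realize (Sum.elim x Subtype.val) := by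
  simp only [realize_listConj]
  exact (Filter.eventually_all_finite (l.finite_toSet)).2 hl

theorem isCompleteTypeOver_typeOfUltrafilter {M : Theory.ModelType.{u, u, u} T} (A : Set M)
    (U : Ultrafilter (γ → M)) : IsCompleteTypeOver M A (typeOfUltrafilter A U) := by
  refine ⟨fun l hl => (eventually_realize_listConj hl).exists, fun φ => ?_⟩
  simp only [typeOfUltrafilter, Set.mem_ofPred_eq, Formula.realize_not, Ultrafilter.eventually_not]
  exact em _

theorem LocalBigness.bigType_typeOfUltrafilter (Γ : LocalBigness L T γ)
    {M : Theory.ModelType.{u, u, u} T} (A : Set M) {U : Ultrafilter (γ → M)}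
    (hU : ↑U ≤ Γ.filter M) : Γ.BigType M A (typeOfUltrafilter A U) := by
  intro l hl
  by_contra hsmall
  have h : ∀ᶠ x in (U : Filter (γ → M)), ¬ (listConj l).Realize (Sum.elim x Subtype.val) := by
    refine hU (Γ.mem_filter.2 ⟨_, hsmall, fun x hx => ?_⟩)
    rw [realize_relabel_sumMap]
    exact not_not.1 hx
  obtain ⟨x, hx, hx'⟩ := ((eventually_realize_listConj hl).and h).exists
  exact hx' hx

theorem restrictT_eq_of_subset {M : Theory.ModelType.{u, u, u} T} {A B : Set M} (hAB : A ⊆ B)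
    {q : Set (L.Formula (γ ⊕ ↥A))} {q' : Set (L.Formula (γ ⊕ ↥B))}
    (hq : IsCompleteTypeOver M A q) (hq' : IsCompleteTypeOver M B q')
    (h : q ⊆ restrictT hAB q') : restrictT hAB q' = q := by
  refine Set.Subset.antisymm (fun φ hφ => (hq.2 φ).resolve_right fun hn => ?_) h
  obtain ⟨x, hx⟩ := hq'.1 [φ.relabel (Sum.map id (Set.inclusion hAB)),
    φ.not.relabel (Sum.map id (Set.inclusion hAB))] (by
      simpa using ⟨hφ, h hn⟩)
  simp only [realize_listConj, List.forall_mem_cons, realize_relabel_sumMap] at hx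
  exact hx.2.1 hx.1

theorem LocalBigness.bigType_iff_finite (Γ : LocalBigness L T γ)
    (M : Theory.ModelType.{u, u, u} T) (A : Set M) (q : Set (L.Formula (γ ⊕ ↥A)))
    (hq : IsCompleteTypeOver M A q) :
    Γ.BigType M A q ↔
      ∀ (B : Set M) (hBA : B ⊆ A), B.Finite → Γ.BigType M B (restrictT hBA q) := by
  constructor
  · intro h B hBA _ l hl
    refine Γ.mono M _ _ (fun x hx => ?_)
      (h (l.map fun φ => φ.relabel (Sum.map id (Set.inclusion hBA))) (List.forall_mem_map.2 hl))
    simp only [realize_relabel_sumMap, realize_listConj, List.forall_mem_map] at hx ⊢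
    exact hx
  · intro h l hl
    obtain ⟨n, c, φ, hφ⟩ := exists_finite_params (listConj l)
    let B : Set M := Set.range fun i => (c i : M)
    have hBA : B ⊆ A := by rintro _ ⟨i, rfl⟩; exact (c i).2
    let ψ : L.Formula (γ ⊕ ↥B) := φ.relabel (Sum.map id fun i => ⟨c i, i, rfl⟩)
    have hψ : ψ ∈ restrictT hBA q := by
      refine hq.mem_of_imp hl fun x hx => ?_
      simp only [ψ, realize_relabel_sumMap]
      exact (hφ M x Subtype.val).2 hx
    refine Γ.mono M _ _ (fun x hx => ?_)
      (h B hBA (Set.finite_range _) [ψ] (by simpa using hψ))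
    simp only [realize_relabel_sumMap, realize_listConj, List.forall_mem_singleton, ψ] at hx
    simp only [realize_relabel_sumMap]
    exact (hφ M x Subtype.val).1 hx

theorem LocalBigness.exists_bigType_extension (Γ : LocalBigness L T γ)
    (M : Theory.ModelType.{u, u, u} T) (A B : Set M) (hAB : A ⊆ B)
    (q : Set (L.Formula (γ ⊕ ↥A))) (hq : IsCompleteTypeOver M A q) (hbig : Γ.BigType M A q) :
    ∃ q' : Set (L.Formula (γ ⊕ ↥B)),
      IsCompleteTypeOver M B q' ∧ Γ.BigType M B q' ∧ restrictT hAB q' = q := by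
  let R : L.Formula (γ ⊕ ↥A) → Set (γ → M) := fun φ => { x | φ.Realize (Sum.elim x Subtype.val) }
  have hne : (Γ.filter M ⊓ Filter.generate (R '' q)).NeBot := by
    refine Filter.inf_neBot_iff.2 fun {s} hs {t} ht => ?_
    obtain ⟨φ, hφ, hs⟩ := Γ.mem_filter.1 hs
    obtain ⟨V, hVq, hV, hVt⟩ := Filter.mem_generate_iff.1 ht
    obtain ⟨W, hWq, hW, rfl⟩ := Set.exists_subset_image_finite_and.1 ⟨V, hVq, hV, rfl⟩
    by_contra hemp
    have hbig' := hbig hW.toFinset.toList fun ψ hψ => hWq (by simpa using hψ)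
    refine hφ (Γ.mono M _ _ (fun x hx => hs x fun hxs => hemp ⟨x, hxs, hVt ?_⟩) hbig')
    rw [realize_relabel_sumMap, realize_listConj] at hx
    simpa [R] using hx
  obtain ⟨U, hU⟩ := Ultrafilter.exists_le (Γ.filter M ⊓ Filter.generate (R '' q))
  have hcomplete := isCompleteTypeOver_typeOfUltrafilter (L := L) B U
  refine ⟨_, hcomplete, Γ.bigType_typeOfUltrafilter B (hU.trans inf_le_left),
    restrictT_eq_of_subset hAB hq hcomplete fun φ hφ => ?_⟩
  have h : R φ ∈ U := hU (Filter.mem_inf_of_right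
    (Filter.mem_generate_of_mem (Set.mem_image_of_mem R hφ)))
  simp only [restrictT, typeOfUltrafilter, Set.mem_ofPred_eq, realize_relabel_sumMap]
  exact h

theorem LocalBigness.exists_bigType (Γ : LocalBigness L T γ)
    (M : Theory.ModelType.{u, u, u} T) (A : Set M) :
    ∃ q : Set (L.Formula (γ ⊕ ↥A)), IsCompleteTypeOver M A q ∧ Γ.BigType M A q := by
  obtain ⟨U, hU⟩ := Ultrafilter.exists_le (Γ.filter M)
  exact ⟨_, isCompleteTypeOver_typeOfUltrafilter A U, Γ.bigType_typeOfUltrafilter A hU⟩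

theorem LocalBigness.Invariant.big_iff_of_elementary {Γ : LocalBigness L T γ} (hΓ : Γ.Invariant)
    (M N : Theory.ModelType.{u, u, u} T) {α : Type u} (v : α → M) (w : α → N)
    (h : ∀ φ : L.Formula α, φ.Realize v ↔ φ.Realize w) (φ : L.Formula (γ ⊕ α)) :
    Γ.Big M (φ.relabel (Sum.map id v)) ↔ Γ.Big N (φ.relabel (Sum.map id w)) := by
  obtain ⟨n, c, φ', hφ⟩ := exists_finite_params φ
  have hM : Γ.Big M (φ.relabel (Sum.map id v)) ↔ Γ.Big M (φ'.relabel (Sum.map id (v ∘ c))) :=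
    Γ.big_congr M fun x => by
      simpa only [realize_relabel_sumMap, Function.id_comp] using (hφ M x v).symm
  have hN : Γ.Big N (φ.relabel (Sum.map id w)) ↔ Γ.Big N (φ'.relabel (Sum.map id (w ∘ c))) :=
    Γ.big_congr N fun x => by
      simpa only [realize_relabel_sumMap, Function.id_comp] using (hφ N x w).symm
  rw [hM, hN]
  refine hΓ M N n φ' (v ∘ c) (w ∘ c) fun ψ => ?_
  simpa only [Formula.realize_relabel] using h (ψ.relabel c)

theorem LocalBigness.Invariant.invariantTypePred {Γ : LocalBigness L T γ} (hΓ : Γ.Invariant) :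
    InvariantTypePred Γ.BigType := by
  intro M N A B a b e he h
  simp only [realize_relabel_sumMap] at h
  have key : ∀ φ : L.Formula (γ ⊕ ↥A), Γ.Big M (φ.relabel (Sum.map id Subtype.val)) ↔
      Γ.Big N (φ.relabel (Sum.map id (Subtype.val ∘ e))) := by
    refine hΓ.big_iff_of_elementary M N _ _ fun ψ => ?_
    simpa [Formula.realize_relabel, Sum.elim_comp_inr] using h (ψ.relabel Sum.inr)
  constructor
  · intro hbig l hl
    obtain ⟨s, hs⟩ := he.hasRightInverse
    have hes : e ∘ s = id := hs.comp_eq_id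
    have hmem : ∀ φ ∈ l.map fun φ => φ.relabel (Sum.map id s), φ ∈ typeOf M A a := by
      simp only [List.forall_mem_map, typeOf, Set.mem_ofPred_eq, h, realize_relabel_sumMap,
        Function.comp_assoc, hes, Function.comp_id]
      exact hl
    refine (Γ.big_congr N fun x => ?_).1 ((key _).1 (hbig _ hmem))
    simp only [realize_relabel_sumMap, realize_listConj, List.forall_mem_map,
      Function.comp_assoc, hes, Function.comp_id]
  · intro hbig l hl
    have hmem : ∀ φ ∈ l.map fun φ => φ.relabel (Sum.map id e), φ ∈ typeOf N B b := by
      simp only [List.forall_mem_map, typeOf, Set.mem_ofPred_eq, realize_relabel_sumMap, ← h]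
      exact hl
    refine (key _).2 ((Γ.big_congr N fun x => ?_).1 (hbig _ hmem))
    simp only [realize_relabel_sumMap, realize_listConj, List.forall_mem_map, Function.id_comp]

/-!
Statement 3 (Claim 1.9): declaring a complete type `p ∈ S(A, M)` to be `Γ`-big iff the
conjunction of every finite subset of `p` is a `Γ`-big formula (that is, `Γ.BigType`)
turns a local bigness notion `Γ` into a global bigness notion: it satisfies local
character, extension and existence; moreover, if `Γ` is invariant as a local bigness
notion, then the induced global bigness notion is invariant.
-/
theorem local_to_global (hT : T.IsComplete) (Γ : LocalBigness L T γ) :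
    -- local character
    (∀ (M : Theory.ModelType.{u, u, u} T) (A : Set M)
        (q : Set (L.Formula (γ ⊕ ↥A))), IsCompleteTypeOver M A q →
        (Γ.BigType M A q ↔
          ∀ (B : Set M) (hBA : B ⊆ A), B.Finite → Γ.BigType M B (restrictT hBA q))) ∧
    -- extension
    (∀ (M : Theory.ModelType.{u, u, u} T) (A B : Set M) (hAB : A ⊆ B)
        (q : Set (L.Formula (γ ⊕ ↥A))), IsCompleteTypeOver M A q → Γ.BigType M A q →
        ∃ q' : Set (L.Formula (γ ⊕ ↥B)),
          IsCompleteTypeOver M B q' ∧ Γ.BigType M B q' ∧ restrictT hAB q' = q) ∧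
    -- existence
    (∀ (M : Theory.ModelType.{u, u, u} T) (A : Set M),
        ∃ q : Set (L.Formula (γ ⊕ ↥A)), IsCompleteTypeOver M A q ∧ Γ.BigType M A q) ∧
    -- invariance transfers from the local to the induced global notion
    (Γ.Invariant → InvariantTypePred Γ.BigType) :=
  ⟨Γ.bigType_iff_finite, Γ.exists_bigType_extension, Γ.exists_bigType,
    fun hΓ => hΓ.invariantTypePred⟩

end Shelah482
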